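/- If C ⊆ ℂ^m is a linear 2-query locally correctable code correcting a δ fraction of errors, then dim(C) ≤ O(1/δ⁹). -/

import Mathlib

open scoped Classical

/-- If for every seed the decoder's two queries outside `T` do not determine the `i`-th symbol,
then erasing `T` defeats the decoder; hence some recovery pair for `i` avoids `T`. -/
theorem exists_recovery_pair {m : ℕ} (C : Submodule ℂ (Fin m → ℂ)) {S : Type} [Fintype S]
    [Nonempty S] (p q : S → Fin m) (f : S → ℂ → ℂ → ℂ) (i : Fin m) (T : Finset (Fin m))
    (hdec : ∀ x ∈ C, ∀ v : Fin m → ℂ, (∀ j ∉ T, v j = 0) →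
      (3 / 4 : ℝ) * (Fintype.card S : ℝ) ≤
        ((Finset.univ.filter fun s : S =>
          f s ((x + v) (p s)) ((x + v) (q s)) = x i).card : ℝ))
    (hi : ∃ x ∈ C, x i ≠ 0) :
    ∃ j ∉ T, ∃ k ∉ T, ∀ x ∈ C, x j = 0 → x k = 0 → x i = 0 := by
  by_contra! hT
  have hw : ∀ s, ∃ w ∈ C, w i ≠ 0 ∧ (p s ∉ T → w (p s) = 0) ∧ (q s ∉ T → w (q s) = 0) := by
    intro s
    by_cases hp : p s ∈ T <;> by_cases hq : q s ∈ T
    · obtain ⟨x, hx, hxi⟩ := hi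
      exact ⟨x, hx, hxi, by simp [hp], by simp [hq]⟩
    · obtain ⟨x, hx, h1, h2, h3⟩ := hT _ hq _ hq
      exact ⟨x, hx, h3, by simp [hp], by simp [h1]⟩
    · obtain ⟨x, hx, h1, h2, h3⟩ := hT _ hp _ hp
      exact ⟨x, hx, h3, by simp [h1], by simp [hq]⟩
    · obtain ⟨x, hx, h1, h2, h3⟩ := hT _ hp _ hq
      exact ⟨x, hx, h3, by simp [h1], by simp [h2]⟩
  choose w hwC hwi hwp hwq using hw
  let x : (S → Bool) → Fin m → ℂ := fun a => ∑ s, if a s then w s else 0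
  let y : (S → Bool) → Fin m → ℂ := fun a j => if j ∈ T then 0 else x a j
  let flip : S → (S → Bool) → (S → Bool) := fun s a => Function.update a s (!a s)
  have hflip : ∀ s a, x (flip s a) - x a = if a s then - w s else w s := by
    intro s a
    simp only [x, flip]
    rw [← Finset.sum_sub_distrib, Finset.sum_eq_single s]
    · cases h : a s <;> simp
    · intro t _ hts
      simp [Function.update_of_ne hts]
    · simp
  have hyflip : ∀ s a j, (j ∉ T → w s j = 0) → y (flip s a) j = y a j := by
    intro s a j hj
    by_cases hjT : j ∈ T
    · simp [y, hjT]
    · have := congrFun (hflip s a) j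
      simp only [y, hjT, if_false]
      rw [← sub_eq_zero]
      simpa [apply_ite, ite_apply, hj hjT] using this
  let good : (S → Bool) → S → Prop := fun a s => f s (y a (p s)) (y a (q s)) = x a i
  have hgood : ∀ s a, good a s → ¬ good (flip s a) s := by
    intro s a h1 h2
    simp only [good] at h1 h2
    rw [hyflip s a _ (hwp s), hyflip s a _ (hwq s), h1] at h2
    have := congrFun (hflip s a) i
    rw [Pi.sub_apply, ← h2, sub_self] at this
    cases h : a s <;> simp [h, hwi s, (hwi s).symm] at this
  have hinv : ∀ s a, flip s (flip s a) = a := by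
    intro s a; simp [flip]
  have hhalf : ∀ s, 2 * (Finset.univ.filter fun a => good a s).card ≤
      Fintype.card (S → Bool) := by
    intro s
    have h1 : (Finset.univ.filter fun a => good a s).card ≤
        (Finset.univ.filter fun a => ¬ good a s).card := by
      refine Finset.card_le_card_of_injOn (flip s) ?_ ?_
      · intro a ha
        simpa using hgood s a (by simpa using ha)
      · intro a _ b _ hab
        rw [← hinv s a, hab, hinv]
    have h2 := Finset.card_filter_add_card_filter_not (s := (Finset.univ : Finset (S → Bool)))
      (fun a => good a s)
    rw [Finset.card_univ] at h2
    omega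
  have hmany : ∀ a, (3 / 4 : ℝ) * (Fintype.card S : ℝ) ≤
      ((Finset.univ.filter fun s => good a s).card : ℝ) := by
    intro a
    have hxa : x a ∈ C := Submodule.sum_mem _ fun s _ => by
      split_ifs
      · exact hwC s
      · exact C.zero_mem
    have := hdec (x a) hxa (fun j => y a j - x a j) (fun j hj => by simp [y, hj])
    convert this using 5
    simp
  have hcount : ∑ a, (Finset.univ.filter fun s => good a s).card =
      ∑ s, (Finset.univ.filter fun a => good a s).card :=
    Finset.sum_card_bipartiteAbove_eq_sum_card_bipartiteBelow (s := Finset.univ)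
      (t := Finset.univ) good
  have h1 : (Fintype.card (S → Bool) : ℝ) * ((3 / 4 : ℝ) * Fintype.card S) ≤
      ∑ a, ((Finset.univ.filter fun s => good a s).card : ℝ) := by
    simpa using Finset.sum_le_sum fun a (_ : a ∈ Finset.univ) => hmany a
  have h2 : ∑ s, ((Finset.univ.filter fun a => good a s).card : ℝ) ≤
      Fintype.card S * ((Fintype.card (S → Bool) : ℝ) / 2) := by
    have : ∀ s ∈ (Finset.univ : Finset S), ((Finset.univ.filter fun a => good a s).card : ℝ) ≤
        (Fintype.card (S → Bool) : ℝ) / 2 := by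
      intro s _
      have := hhalf s
      have : (2 : ℝ) * (Finset.univ.filter fun a => good a s).card ≤
        Fintype.card (S → Bool) := by exact_mod_cast this
      linarith
    have := Finset.sum_le_sum this
    rwa [Finset.sum_const, Finset.card_univ, nsmul_eq_mul] at this
  have h3 : ∑ a, ((Finset.univ.filter fun s => good a s).card : ℝ) =
      ∑ s, ((Finset.univ.filter fun a => good a s).card : ℝ) := by exact_mod_cast hcount
  have h4 : (0 : ℝ) < Fintype.card (S → Bool) := by exact_mod_cast Fintype.card_pos
  have h5 : (0 : ℝ) < Fintype.card S := by exact_mod_cast Fintype.card_pos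
  nlinarith [mul_pos h4 h5]

section sqCos

variable {E : Type*} [NormedAddCommGroup E] [InnerProductSpace ℂ E]

/-- The squared cosine of the angle between two vectors of a complex inner product space. -/
noncomputable def sqCos (x y : E) : ℝ := (‖inner ℂ x y‖ / (‖x‖ * ‖y‖)) ^ 2

theorem sqCos_nonneg (x y : E) : 0 ≤ sqCos x y := sq_nonneg _

theorem sqCos_comm (x y : E) : sqCos x y = sqCos y x := by
  rw [sqCos, sqCos, norm_inner_symm, mul_comm]

theorem sqCos_eq_one_of_mem_span {x y : E} (hy : y ≠ 0) (h : y ∈ Submodule.span ℂ {x}) :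
    sqCos x y = 1 := by
  obtain ⟨a, rfl⟩ := Submodule.mem_span_singleton.1 h
  have ha : ‖a‖ ≠ 0 := norm_ne_zero_iff.2 (left_ne_zero_of_smul hy)
  have hx : ‖x‖ ≠ 0 := norm_ne_zero_iff.2 (right_ne_zero_of_smul hy)
  rw [sqCos, inner_smul_right, norm_mul, norm_smul, inner_self_eq_norm_sq_to_K]
  simp only [norm_pow, Complex.coe_algebraMap, Complex.norm_real, norm_norm]
  field_simp

theorem half_le_sqCos_add_sqCos {x y z : E} {a b c : ℂ} (hx : x ≠ 0) (hy : y ≠ 0) (hz : z ≠ 0)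
    (hc : c ≠ 0) (h : a • x + b • y + c • z = 0) (hac : ‖a‖ * ‖x‖ ≤ ‖c‖ * ‖z‖)
    (hbc : ‖b‖ * ‖y‖ ≤ ‖c‖ * ‖z‖) : 1 / 2 ≤ sqCos z x + sqCos z y := by
  have hx' : 0 < ‖x‖ := norm_pos_iff.2 hx
  have hy' : 0 < ‖y‖ := norm_pos_iff.2 hy
  have hz' : 0 < ‖z‖ := norm_pos_iff.2 hz
  have hc' : 0 < ‖c‖ := norm_pos_iff.2 hc
  unfold sqCos
  set p := ‖inner ℂ z x‖ / (‖z‖ * ‖x‖) with hp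
  set q := ‖inner ℂ z y‖ / (‖z‖ * ‖y‖) with hq
  have hp0 : 0 ≤ p := by positivity
  have hq0 : 0 ≤ q := by positivity
  have hpx : ‖inner ℂ z x‖ = p * (‖z‖ * ‖x‖) := by rw [hp]; field_simp
  have hqy : ‖inner ℂ z y‖ = q * (‖z‖ * ‖y‖) := by rw [hq]; field_simp
  have h1 : c * inner ℂ z z = -(a * inner ℂ z x + b * inner ℂ z y) := by
    have := congrArg (inner ℂ z) h
    simp only [inner_add_right, inner_smul_right, inner_zero_right] at this
    linear_combination this
  have h2 : ‖c‖ * ‖z‖ ^ 2 ≤ ‖a‖ * ‖inner ℂ z x‖ + ‖b‖ * ‖inner ℂ z y‖ := by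
    calc ‖c‖ * ‖z‖ ^ 2 = ‖c * inner ℂ z z‖ := by
          rw [norm_mul, inner_self_eq_norm_sq_to_K]; simp
      _ ≤ _ := by
          rw [h1, norm_neg]
          exact (norm_add_le _ _).trans (by simp)
  have h3 : (‖c‖ * ‖z‖) * ‖z‖ ≤ (‖c‖ * ‖z‖) * ‖z‖ * (p + q) := by
    rw [hpx, hqy] at h2
    have e1 := mul_le_mul_of_nonneg_right hac (mul_nonneg hp0 hz'.le)
    have e2 := mul_le_mul_of_nonneg_right hbc (mul_nonneg hq0 hz'.le)
    nlinarith
  have h4 : 1 ≤ p + q := by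
    have : 0 < (‖c‖ * ‖z‖) * ‖z‖ := by positivity
    exact (le_mul_iff_one_le_right this).1 h3
  nlinarith [sq_nonneg (p - q)]

/-- Among three linearly dependent nonzero vectors some two are far from orthogonal. -/
theorem half_le_sqCos_of_mem_span_pair {x y z : E} (hx : x ≠ 0) (hy : y ≠ 0) (hz : z ≠ 0)
    (h : z ∈ Submodule.span ℂ {x, y}) : 1 / 2 ≤ sqCos x y + sqCos x z + sqCos y z := by
  obtain ⟨a, b, rfl⟩ := Submodule.mem_span_pair.1 h
  set z := a • x + b • y with hzdef
  have hrel : a • x + b • y + (-1 : ℂ) • z = 0 := by rw [hzdef]; module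
  have n1 := sqCos_nonneg x y
  have n2 := sqCos_nonneg x z
  have n3 := sqCos_nonneg y z
  have hz' : 0 < ‖(-1 : ℂ)‖ * ‖z‖ := by simpa using hz
  rcases le_total (‖a‖ * ‖x‖) (‖(-1 : ℂ)‖ * ‖z‖) with h1 | h1 <;>
  rcases le_total (‖b‖ * ‖y‖) (‖(-1 : ℂ)‖ * ‖z‖) with h2 | h2 <;>
  rcases le_total (‖a‖ * ‖x‖) (‖b‖ * ‖y‖) with h3 | h3
  · have := half_le_sqCos_add_sqCos hx hy hz (by simp) hrel h1 h2
    rw [sqCos_comm z, sqCos_comm z] at this; linarith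
  · have := half_le_sqCos_add_sqCos hx hy hz (by simp) hrel h1 h2
    rw [sqCos_comm z, sqCos_comm z] at this; linarith
  all_goals
    first
    | have hb : b ≠ 0 := by
        rintro rfl
        simp only [norm_zero, zero_mul] at h2 h3
        linarith
      have := half_le_sqCos_add_sqCos (c := b) hx hz hy hb
        (by rw [← hrel]; module : a • x + (-1 : ℂ) • z + b • y = 0) (by linarith) (by linarith)
      rw [sqCos_comm y x] at this
      linarith
    | have ha : a ≠ 0 := by
        rintro rfl
        simp only [norm_zero, zero_mul] at h1 h3
        linarith
      have := half_le_sqCos_add_sqCos (c := a) hy hz hx ha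
        (by rw [← hrel]; module : b • y + (-1 : ℂ) • z + a • x = 0) (by linarith) (by linarith)
      linarith

end sqCos

section DependentTriple

variable {E : Type*} [AddCommGroup E] [Module ℂ E]

theorem mem_span_singleton_symm {x y : E} (hy : y ≠ 0) (h : y ∈ Submodule.span ℂ {x}) :
    x ∈ Submodule.span ℂ {y} := by
  have := mem_span_insert_exchange (K := ℂ) (s := (∅ : Set E)) (x := y) (y := x)
    (by simpa using h) (by simpa using hy)
  simpa using this

/-- Three pairwise non-parallel vectors spanning a plane. -/
def DependentTriple (x y z : E) : Prop :=
  z ∈ Submodule.span ℂ {x, y} ∧ z ∉ Submodule.span ℂ {x} ∧ z ∉ Submodule.span ℂ {y} ∧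
    y ∉ Submodule.span ℂ {x}

theorem DependentTriple.swap {x y z : E} (hx : x ≠ 0) (h : DependentTriple x y z) :
    DependentTriple y x z :=
  ⟨by rw [Set.pair_comm]; exact h.1, h.2.2.1, h.2.1,
    fun h' => h.2.2.2 (mem_span_singleton_symm hx h')⟩

theorem DependentTriple.swap_right {x y z : E} (hy : y ≠ 0) (h : DependentTriple x y z) :
    DependentTriple x z y := by
  refine ⟨?_, h.2.2.2, fun h' => h.2.2.1 (mem_span_singleton_symm hy h'), h.2.1⟩
  have := mem_span_insert_exchange (K := ℂ) (s := {x}) (x := z) (y := y)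
    (by rw [Set.pair_comm]; exact h.1) h.2.1
  rwa [Set.pair_comm]

theorem DependentTriple.span_eq {x y z : E} (h : DependentTriple x y z) :
    Submodule.span ℂ {x, y, z} = Submodule.span ℂ {x, y} := by
  have : ({x, y, z} : Set E) = insert z {x, y} := by
    ext; simp only [Set.mem_insert_iff, Set.mem_singleton_iff]; tauto
  rw [this, Submodule.span_insert_eq_span h.1]

end DependentTriple

section Counting

variable {E : Type*} [NormedAddCommGroup E] [InnerProductSpace ℂ E] {ι : Type*} [Fintype ι]

/-- The number of vectors of the family lying in a subspace. -/
noncomputable def countIn (e : ι → E) (W : Submodule ℂ E) : ℕ :=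
  (Finset.univ.filter fun l => e l ∈ W).card

/-- The weight of a triple of indices: dependent triples are weighted by the inverse of the number
of vectors in the plane they span. -/
noncomputable def tripleWeight (e : ι → E) (i j k : ι) : ℝ :=
  if DependentTriple (e i) (e j) (e k) then
    1 / (countIn e (Submodule.span ℂ {e i, e j, e k}) : ℝ) else 0

variable {e : ι → E}

theorem tripleWeight_nonneg (i j k : ι) : 0 ≤ tripleWeight e i j k := by
  unfold tripleWeight; split_ifs <;> positivity

theorem tripleWeight_swap (he : ∀ i, e i ≠ 0) (i j k : ι) :
    tripleWeight e i j k = tripleWeight e j i k := by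
  have h : DependentTriple (e i) (e j) (e k) ↔ DependentTriple (e j) (e i) (e k) :=
    ⟨.swap (he i), .swap (he j)⟩
  rw [tripleWeight, tripleWeight, Set.insert_comm]
  simp only [h]

theorem tripleWeight_swap_right (he : ∀ i, e i ≠ 0) (i j k : ι) :
    tripleWeight e i j k = tripleWeight e i k j := by
  have h : DependentTriple (e i) (e j) (e k) ↔ DependentTriple (e i) (e k) (e j) :=
    ⟨.swap_right (he j), .swap_right (he k)⟩
  rw [tripleWeight, tripleWeight, Set.pair_comm (e j)]
  simp only [h]

theorem sum_tripleWeight (i j : ι) :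
    ∑ k, tripleWeight e i j k =
      (Finset.univ.filter fun k => DependentTriple (e i) (e j) (e k)).card /
        (countIn e (Submodule.span ℂ {e i, e j}) : ℝ) := by
  have : ∀ k, tripleWeight e i j k = if DependentTriple (e i) (e j) (e k) then
      1 / (countIn e (Submodule.span ℂ {e i, e j}) : ℝ) else 0 := by
    intro k
    unfold tripleWeight
    split_ifs with h
    · rw [h.span_eq]
    · rfl
  simp only [this, ← Finset.sum_filter, Finset.sum_const, nsmul_eq_mul]
  ring

theorem sum_tripleWeight_le_one (i j : ι) : ∑ k, tripleWeight e i j k ≤ 1 := by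
  rw [sum_tripleWeight]
  refine div_le_one_of_le₀ ?_ (by positivity)
  exact_mod_cast Finset.card_le_card (Finset.monotone_filter_right _
    fun k _ (h : DependentTriple (e i) (e j) (e k)) => h.1)

theorem sum_tripleWeight_mul_le (he : ∀ i, e i ≠ 0) {L : ℝ}
    (hL : ∀ i, ∑ j, sqCos (e i) (e j) ≤ L) :
    ∑ i, ∑ j, ∑ k, tripleWeight e i j k ≤ 6 * (Fintype.card ι * L) := by
  have h1 : ∀ i j k, tripleWeight e i j k ≤ 2 * (tripleWeight e i j k * sqCos (e i) (e j)
      + tripleWeight e i k j * sqCos (e i) (e k) + tripleWeight e j k i * sqCos (e j) (e k)) := by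
    intro i j k
    rw [tripleWeight_swap_right he i k j, tripleWeight_swap_right he j k i,
      tripleWeight_swap he j i k]
    by_cases h : DependentTriple (e i) (e j) (e k)
    · have := half_le_sqCos_of_mem_span_pair (he i) (he j) (he k) h.1
      nlinarith [tripleWeight_nonneg (e := e) i j k]
    · simp [tripleWeight, h]
  have h2 : ∑ i, ∑ j, ∑ k, tripleWeight e i j k * sqCos (e i) (e j) ≤ Fintype.card ι * L := by
    have : ∀ i ∈ Finset.univ, ∑ j, ∑ k, tripleWeight e i j k * sqCos (e i) (e j) ≤ L := by
      intro i _
      refine le_trans (Finset.sum_le_sum fun j _ => ?_) (hL i)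
      rw [← Finset.sum_mul]
      exact mul_le_of_le_one_left (sqCos_nonneg _ _) (sum_tripleWeight_le_one i j)
    simpa using Finset.sum_le_sum this
  have h3 : ∑ i, ∑ j, ∑ k, tripleWeight e i k j * sqCos (e i) (e k) =
      ∑ i, ∑ j, ∑ k, tripleWeight e i j k * sqCos (e i) (e j) :=
    Finset.sum_congr rfl fun i _ => Finset.sum_comm
  have h4 : ∑ i, ∑ j, ∑ k, tripleWeight e j k i * sqCos (e j) (e k) =
      ∑ i, ∑ j, ∑ k, tripleWeight e i j k * sqCos (e i) (e j) := by
    rw [Finset.sum_comm]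
    exact Finset.sum_congr rfl fun i _ => Finset.sum_comm
  calc _ ≤ ∑ i, ∑ j, ∑ k, 2 * (tripleWeight e i j k * sqCos (e i) (e j)
      + tripleWeight e i k j * sqCos (e i) (e k) + tripleWeight e j k i * sqCos (e j) (e k)) :=
        Finset.sum_le_sum fun i _ => Finset.sum_le_sum fun j _ => Finset.sum_le_sum fun k _ =>
          h1 i j k
    _ ≤ _ := by
        simp only [← Finset.mul_sum, Finset.sum_add_distrib]
        rw [h3, h4]
        linarith

theorem countIn_le (he : ∀ i, e i ≠ 0) {L : ℝ} (hL : ∀ i, ∑ j, sqCos (e i) (e j) ≤ L) (i : ι) :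
    (countIn e (Submodule.span ℂ {e i}) : ℝ) ≤ L := by
  refine le_trans ?_ (hL i)
  rw [countIn, Finset.card_filter, Nat.cast_sum]
  refine Finset.sum_le_sum fun j _ => ?_
  split_ifs with h
  · rw [sqCos_eq_one_of_mem_span (he j) h]; simp
  · simpa using sqCos_nonneg _ _

theorem countIn_le_card_dependentTriple (he : ∀ i, e i ≠ 0) {i j k : ι}
    (h : DependentTriple (e i) (e j) (e k)) :
    countIn e (Submodule.span ℂ {e k}) ≤
      (Finset.univ.filter fun l => DependentTriple (e i) (e j) (e l)).card := by
  refine Finset.card_le_card (Finset.monotone_filter_right _ fun l _ hl => ?_)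
  have hkl := mem_span_singleton_symm (he l) hl
  have key : ∀ {W : Submodule ℂ E}, e l ∈ W → e k ∈ W := fun hW =>
    (Submodule.span_singleton_le_iff_mem _ _).2 hW hkl
  exact ⟨(Submodule.span_singleton_le_iff_mem _ _).2 h.1 hl, fun h' => h.2.1 (key h'),
    fun h' => h.2.2.1 (key h'), h.2.2.2⟩

theorem countIn_span_pair_le {i j : ι} (hij : e j ∉ Submodule.span ℂ {e i}) :
    countIn e (Submodule.span ℂ {e i, e j}) ≤
      (Finset.univ.filter fun l => DependentTriple (e i) (e j) (e l)).card +
        (countIn e (Submodule.span ℂ {e i}) + countIn e (Submodule.span ℂ {e j})) := by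
  refine le_trans (Finset.card_le_card ?_) ((Finset.card_union_le _ _).trans
    (Nat.add_le_add_left (Finset.card_union_le _ _) _))
  intro l hl
  simp only [Finset.mem_filter, Finset.mem_union, Finset.mem_univ, true_and] at hl ⊢
  by_cases h1 : e l ∈ Submodule.span ℂ {e i}
  · tauto
  by_cases h2 : e l ∈ Submodule.span ℂ {e j}
  · tauto
  exact Or.inl ⟨hl, h1, h2, hij⟩

theorem one_quarter_le_of_dependentTriple (he : ∀ i, e i ≠ 0) {i j k : ι}
    (h : DependentTriple (e i) (e j) (e k))
    (hcj : countIn e (Submodule.span ℂ {e i}) ≤ countIn e (Submodule.span ℂ {e j})) :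
    1 / 4 ≤ ∑ l, tripleWeight e i j l ∨ 1 / 4 ≤ ∑ l, tripleWeight e i k l := by
  have h' := h.swap_right (he j)
  have hN : Submodule.span ℂ {e i, e k} = Submodule.span ℂ {e i, e j} := by
    rw [← h.span_eq, ← h'.span_eq, Set.pair_comm (e j)]
  have hpos : 0 < countIn e (Submodule.span ℂ {e i, e j}) :=
    Finset.card_pos.2 ⟨i, by simpa using Submodule.subset_span (Set.mem_insert _ _)⟩
  have h1 := countIn_le_card_dependentTriple he h'
  have h2 := countIn_span_pair_le h.2.2.2
  rw [sum_tripleWeight, sum_tripleWeight, hN, le_div_iff₀ (by exact_mod_cast hpos),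
    le_div_iff₀ (by exact_mod_cast hpos)]
  by_contra! hcon
  obtain ⟨c1, c2⟩ := hcon
  have h1' : (countIn e (Submodule.span ℂ {e j}) : ℝ) ≤
    (Finset.univ.filter fun l => DependentTriple (e i) (e k) (e l)).card := by exact_mod_cast h1
  have h2' : (countIn e (Submodule.span ℂ {e i, e j}) : ℝ) ≤
      (Finset.univ.filter fun l => DependentTriple (e i) (e j) (e l)).card +
        (countIn e (Submodule.span ℂ {e i}) + countIn e (Submodule.span ℂ {e j})) := by
    exact_mod_cast h2
  have h3' : (countIn e (Submodule.span ℂ {e i}) : ℝ) ≤ countIn e (Submodule.span ℂ {e j}) := by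
    exact_mod_cast hcj
  have : (0 : ℝ) < countIn e (Submodule.span ℂ {e i, e j}) := by exact_mod_cast hpos
  linarith

theorem le_sum_tripleWeight (he : ∀ i, e i ≠ 0) {L D r : ℝ}
    (hL : ∀ i, ∑ j, sqCos (e i) (e j) ≤ L) (i : ι)
    (hD : ∀ T : Finset ι, (T.card : ℝ) ≤ D →
      ∃ j ∉ T, ∃ k ∉ T, e i ∈ Submodule.span ℂ {e j, e k})
    (hr : ((Finset.univ.filter fun j =>
      countIn e (Submodule.span ℂ {e j}) < countIn e (Submodule.span ℂ {e i})).card : ℝ) ≤ r) :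
    (D - L - r) / 4 ≤ ∑ j, ∑ k, tripleWeight e i j k := by
  set A := Finset.univ.filter fun j => e j ∈ Submodule.span ℂ {e i} with hA
  set B := Finset.univ.filter fun j =>
      countIn e (Submodule.span ℂ {e j}) < countIn e (Submodule.span ℂ {e i}) with hB
  set F := Finset.univ.filter fun j => 1 / 4 ≤ ∑ l, tripleWeight e i j l with hF
  have hcard : D < ((A ∪ B ∪ F).card : ℝ) := by
    by_contra! hle
    obtain ⟨j, hj, k, hk, hi⟩ := hD _ hle
    simp only [hA, hB, hF, Finset.mem_union, Finset.mem_filter, Finset.mem_univ, true_and,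
      not_or, not_lt] at hj hk
    obtain ⟨⟨hj1, hj2⟩, hj3⟩ := hj
    obtain ⟨⟨hk1, hk2⟩, hk3⟩ := hk
    have hik : e i ∉ Submodule.span ℂ {e k} := fun h' => hk1 (mem_span_singleton_symm (he i) h')
    have hij : e i ∉ Submodule.span ℂ {e j} := fun h' => hj1 (mem_span_singleton_symm (he i) h')
    have hjk : e k ∉ Submodule.span ℂ {e j} := fun h' =>
      hij (by rwa [Set.pair_comm, Submodule.span_insert_eq_span h'] at hi)
    have hT : DependentTriple (e j) (e k) (e i) := ⟨hi, hij, hik, hjk⟩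
    have hT' := (hT.swap_right (he k)).swap (he j)
    rcases one_quarter_le_of_dependentTriple he hT' hj2 with h | h
    · exact hj3 h
    · exact hk3 h
  have hAL : (A.card : ℝ) ≤ L := countIn_le he hL i
  have hsum : (F.card : ℝ) * (1 / 4) ≤ ∑ j, ∑ k, tripleWeight e i j k := by
    calc (F.card : ℝ) * (1 / 4) = ∑ j ∈ F, (1 / 4 : ℝ) := by simp
      _ ≤ ∑ j ∈ F, ∑ k, tripleWeight e i j k :=
          Finset.sum_le_sum fun j hj => (Finset.mem_filter.1 hj).2
      _ ≤ _ := Finset.sum_le_sum_of_subset_of_nonneg (Finset.subset_univ _) fun j _ _ =>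
          Finset.sum_nonneg fun k _ => tripleWeight_nonneg i j k
  have hu : ((A ∪ B ∪ F).card : ℝ) ≤ A.card + B.card + F.card := by
    exact_mod_cast (Finset.card_union_le _ _).trans
      (Nat.add_le_add_right (Finset.card_union_le _ _) _)
  linarith

theorem le_card_filter_card_filter_lt_le (c : ι → ℕ) {r : ℝ} (hr : r ≤ Fintype.card ι) :
    r ≤ ((Finset.univ.filter fun i =>
      ((Finset.univ.filter fun j => c j < c i).card : ℝ) ≤ r).card : ℝ) := by
  set Y := Finset.univ.filter fun i =>
      ((Finset.univ.filter fun j => c j < c i).card : ℝ) ≤ r with hY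
  by_cases h : Y = Finset.univ
  · rwa [h, Finset.card_univ]
  · obtain ⟨i, hi, hmin⟩ := Finset.exists_min_image Yᶜ c
      (by rwa [Finset.nonempty_iff_ne_empty, Ne, Finset.compl_eq_empty_iff])
    have hi' : r < ((Finset.univ.filter fun j => c j < c i).card : ℝ) := by
      simpa [hY] using hi
    refine hi'.le.trans ?_
    exact_mod_cast Finset.card_le_card fun j hj => by
      by_contra hjY
      exact absurd (hmin j (Finset.mem_compl.2 hjY)) (not_le.2 (Finset.mem_filter.1 hj).2)

/-- A family in which every vector is recoverable from two vectors outside any set of size at most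
`D` cannot be close to isotropic. -/
theorem mul_le_of_recovery (he : ∀ i, e i ≠ 0) {L D r : ℝ}
    (hL : ∀ i, ∑ j, sqCos (e i) (e j) ≤ L)
    (hD : ∀ i, ∀ T : Finset ι, (T.card : ℝ) ≤ D →
      ∃ j ∉ T, ∃ k ∉ T, e i ∈ Submodule.span ℂ {e j, e k})
    (hr : r ≤ Fintype.card ι) (hLr : 0 ≤ D - L - r) :
    r * ((D - L - r) / 4) ≤ 6 * (Fintype.card ι * L) := by
  refine le_trans ?_ (sum_tripleWeight_mul_le he hL)
  set Y := Finset.univ.filter fun i => ((Finset.univ.filter fun j =>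
    countIn e (Submodule.span ℂ {e j}) < countIn e (Submodule.span ℂ {e i})).card : ℝ) ≤ r
  calc r * ((D - L - r) / 4) ≤ Y.card * ((D - L - r) / 4) :=
        mul_le_mul_of_nonneg_right (le_card_filter_card_filter_lt_le _ hr) (by linarith)
    _ = ∑ i ∈ Y, (D - L - r) / 4 := by simp
    _ ≤ ∑ i ∈ Y, ∑ j, ∑ k, tripleWeight e i j k := Finset.sum_le_sum fun i hi =>
        le_sum_tripleWeight he hL i (hD i) (Finset.mem_filter.1 hi).2
    _ ≤ _ := Finset.sum_le_sum_of_subset_of_nonneg (Finset.subset_univ _) fun i _ _ =>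
        Finset.sum_nonneg fun j _ => Finset.sum_nonneg fun k _ => tripleWeight_nonneg i j k

end Counting

section Greedy

theorem Finset.mul_sum_range_le_of_antitone {c t : ℕ → ℝ} (ht : Antitone t) (n : ℕ)
    (hc : ∀ k ≤ n, 0 ≤ ∑ i ∈ Finset.range k, c i) :
    t n * ∑ i ∈ Finset.range n, c i ≤ ∑ i ∈ Finset.range n, c i * t i := by
  induction n with
  | zero => simp
  | succ n ih =>
    have h1 := ih fun k hk => hc k (by omega)
    have h2 := mul_le_mul_of_nonneg_right (ht n.le_succ) (hc (n + 1) le_rfl)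
    rw [Finset.sum_range_succ] at h2 ⊢
    rw [Finset.sum_range_succ, Nat.succ_eq_add_one] at *
    nlinarith

variable {E : Type*} [AddCommGroup E] [Module ℂ E]

theorem finrank_span_image_of_linearIndepOn {ι : Type*} {v : ι → E} {B : Finset ι}
    (h : LinearIndepOn ℂ v B) : Module.finrank ℂ (Submodule.span ℂ (v '' B)) = B.card := by
  have := finrank_span_eq_card h
  rw [← Set.image_eq_range] at this
  simpa using this

/-- The indices picked by the greedy algorithm from the first `k` vectors of a sequence. -/
noncomputable def greedyBasis (w : ℕ → E) (k : ℕ) : Finset ℕ :=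
  (Finset.range k).filter fun l => w l ∉ Submodule.span ℂ (w '' Finset.range l)

theorem greedyBasis_spec (w : ℕ → E) (k : ℕ) :
    LinearIndepOn ℂ w (greedyBasis w k : Set ℕ) ∧
      Submodule.span ℂ (w '' greedyBasis w k) = Submodule.span ℂ (w '' Finset.range k) := by
  induction k with
  | zero => simp [greedyBasis]
  | succ k ih =>
    have hr : w '' Finset.range (k + 1) = insert (w k) (w '' Finset.range k) := by
      rw [Finset.range_add_one, Finset.coe_insert, Set.image_insert_eq]
    by_cases h : w k ∈ Submodule.span ℂ (w '' Finset.range k)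
    · have : greedyBasis w (k + 1) = greedyBasis w k := by
        rw [greedyBasis, Finset.range_add_one, Finset.filter_insert, if_neg (not_not.2 h),
          greedyBasis]
      rw [this, hr, Submodule.span_insert_eq_span h]
      exact ih
    · have : greedyBasis w (k + 1) = insert k (greedyBasis w k) := by
        rw [greedyBasis, Finset.range_add_one, Finset.filter_insert, if_pos h, greedyBasis]
      rw [this, Finset.coe_insert]
      refine ⟨ih.1.insert (by rwa [ih.2]), ?_⟩
      rw [hr, Set.image_insert_eq, Submodule.span_insert, Submodule.span_insert, ih.2]

/-- If no subspace contains more than its proportional share of a family of vectors, then for all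
weights some basis from the family carries at least its proportional share of the weight. -/
theorem exists_basis_weight_ge {ι : Type*} [Fintype ι] [Nonempty ι] (v : ι → E)
    (t : ι → ℝ) (d : ℕ) (hfin : Module.finrank ℂ E = d) [FiniteDimensional ℂ E]
    (hv : ∀ A : Finset ι, A.card * d ≤
      Fintype.card ι * Module.finrank ℂ (Submodule.span ℂ (v '' A))) :
    ∃ B : Finset ι, LinearIndepOn ℂ v (B : Set ι) ∧ B.card = d ∧
      d * ∑ i, t i ≤ Fintype.card ι * ∑ i ∈ B, t i := by
  set n := Fintype.card ι with hn
  have hn0 : 0 < n := Fintype.card_pos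
  let e₀ : Fin n ≃ ι := (Fintype.equivFin ι).symm
  let σ : Fin n ≃ ι := (Tuple.sort fun i => - t (e₀ i)).trans e₀
  have hσ : Antitone (t ∘ σ) := by
    have := Tuple.monotone_sort fun i => - t (e₀ i)
    intro i j hij
    exact neg_le_neg_iff.1 (this hij)
  let g : ℕ → Fin n := fun k => ⟨min k (n - 1), by omega⟩
  have hg : Monotone g := fun a b hab => by
    simp only [g, Fin.mk_le_mk]; omega
  let a : ℕ → ι := σ ∘ g
  have hat : Antitone (t ∘ a) := hσ.comp_monotone hg
  have hinj : Set.InjOn a (Finset.range n) := by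
    intro x hx y hy hxy
    have := congrArg Fin.val (σ.injective hxy)
    simp only [g, Finset.coe_range, Set.mem_Iio] at this hx hy
    omega
  have hinj' : ∀ k ≤ n, Set.InjOn a (Finset.range k) := fun k hk => hinj.mono (by
    intro x; simp only [Finset.coe_range, Set.mem_Iio]; omega)
  have himg : (Finset.range n).image a = Finset.univ := by
    rw [← Finset.card_eq_iff_eq_univ, Finset.card_image_of_injOn hinj, Finset.card_range]
  have hcard : ∀ k ≤ n, k * d ≤ n * (greedyBasis (v ∘ a) k).card := by
    intro k hk
    have h1 := hv ((Finset.range k).image a)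
    rw [Finset.card_image_of_injOn (hinj' k hk), Finset.card_range, Finset.coe_image,
      ← Set.image_comp, ← (greedyBasis_spec (v ∘ a) k).2,
      finrank_span_image_of_linearIndepOn (greedyBasis_spec (v ∘ a) k).1] at h1
    exact h1
  have hsub : (greedyBasis (v ∘ a) n : Set ℕ) ⊆ Finset.range n := by
    exact_mod_cast Finset.filter_subset _ _
  have hle : (greedyBasis (v ∘ a) n).card ≤ d := by
    rw [← hfin, ← finrank_span_image_of_linearIndepOn (greedyBasis_spec (v ∘ a) n).1]
    exact Submodule.finrank_le _
  have hB : (greedyBasis (v ∘ a) n).card = d :=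
    le_antisymm hle (Nat.le_of_mul_le_mul_left (hcard n le_rfl) hn0)
  refine ⟨(greedyBasis (v ∘ a) n).image a, ?_, ?_, ?_⟩
  · rw [Finset.coe_image]
    exact LinearIndepOn.image_of_comp _ _ (greedyBasis_spec (v ∘ a) n).1
  · rw [Finset.card_image_of_injOn (hinj.mono hsub), hB]
  · rw [Finset.sum_image (hinj.mono hsub), ← himg, Finset.sum_image hinj]
    let c : ℕ → ℝ := fun l =>
      (if v (a l) ∉ Submodule.span ℂ ((v ∘ a) '' Finset.range l) then (n : ℝ) else 0) - d
    have hc : ∀ k, ∑ i ∈ Finset.range k, c i = n * (greedyBasis (v ∘ a) k).card - k * d := by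
      intro k
      simp only [c, Finset.sum_sub_distrib, ← Finset.sum_filter, Finset.sum_const, nsmul_eq_mul,
        Finset.card_range]
      rw [mul_comm (n : ℝ)]
      rfl
    have key := Finset.mul_sum_range_le_of_antitone (c := c) hat n (fun k hk => by
      rw [hc]
      have : (k : ℝ) * d ≤ n * (greedyBasis (v ∘ a) k).card := by exact_mod_cast hcard k hk
      linarith)
    rw [hc, hB, sub_self, mul_zero] at key
    have hexp : ∑ i ∈ Finset.range n, c i * (t ∘ a) i =
        n * ∑ i ∈ greedyBasis (v ∘ a) n, t (a i) - d * ∑ i ∈ Finset.range n, t (a i) := by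
      simp only [c, sub_mul, Finset.sum_sub_distrib, ← Finset.mul_sum, ite_mul, zero_mul,
        ← Finset.sum_filter, Function.comp_apply]
      rfl
    linarith

end Greedy

section Frame

open Matrix

open scoped ComplexOrder

variable {d : ℕ}

/-- The restriction to `s` of the frame operator of the family `v` with weights `z`. -/
noncomputable def frameMatrix {ι : Type*} (v : ι → Fin d → ℂ) (z : ι → ℝ) (s : Finset ι) :
    Matrix (Fin d) (Fin d) ℂ :=
  ∑ i ∈ s, (z i : ℂ) • vecMulVec (v i) (star (v i))

theorem posSemidef_smul_vecMulVec (u : Fin d → ℂ) {z : ℝ} (hz : 0 ≤ z) :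
    ((z : ℂ) • vecMulVec u (star u)).PosSemidef :=
  (posSemidef_vecMulVec_self_star u).smul (by exact_mod_cast hz)

theorem norm_det_add_smul_vecMulVec {P : Matrix (Fin d) (Fin d) ℂ} (hP : P.PosDef)
    (u : Fin d → ℂ) {z : ℝ} (hz : 0 ≤ z) :
    ‖(P + (z : ℂ) • vecMulVec u (star u)).det‖ =
      ‖P.det‖ * (1 + z * (star u ⬝ᵥ P⁻¹ *ᵥ u).re) := by
  have hunit : IsUnit P.det := (isUnit_iff_isUnit_det _).1 hP.isUnit
  have h0 : 0 ≤ star u ⬝ᵥ P⁻¹ *ᵥ u := hP.inv.posSemidef.dotProduct_mulVec_nonneg u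
  obtain ⟨hre, him⟩ := Complex.nonneg_iff.1 h0
  have h1 : (z : ℂ) • vecMulVec u (star u) =
      replicateCol Unit ((z : ℂ) • u) * replicateRow Unit (star u) := by
    rw [← vecMulVec_eq, smul_vecMulVec]
  have h2 : (replicateRow Unit (star u) * P⁻¹ * replicateCol Unit ((z : ℂ) • u)) () () =
      ((z * (star u ⬝ᵥ P⁻¹ *ᵥ u).re : ℝ) : ℂ) := by
    have h3 : (star u ⬝ᵥ P⁻¹ *ᵥ u) = ((star u ⬝ᵥ P⁻¹ *ᵥ u).re : ℂ) :=
      Complex.ext rfl (by simpa using him.symm)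
    have h4 : (replicateRow Unit (star u) * P⁻¹ * replicateCol Unit ((z : ℂ) • u)) () () =
        star u ⬝ᵥ P⁻¹ *ᵥ ((z : ℂ) • u) := by
      rw [dotProduct_mulVec, Matrix.mul_apply']
      rfl
    rw [h4, mulVec_smul, dotProduct_smul, h3, smul_eq_mul]
    push_cast
    rfl
  rw [h1, det_add_replicateCol_mul_replicateRow hunit, norm_mul]
  congr 1
  rw [det_unique (n := Unit), PUnit.default_eq_unit, Matrix.add_apply, one_apply_eq, h2,
    ← Complex.ofReal_one, ← Complex.ofReal_add, Complex.norm_real, Real.norm_of_nonneg]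
  positivity

variable {ι : Type*} {v : ι → Fin d → ℂ}

theorem posDef_add_frameMatrix {P : Matrix (Fin d) (Fin d) ℂ} (hP : P.PosDef) {z : ι → ℝ}
    (hz : ∀ i, 0 ≤ z i) (s : Finset ι) : (P + frameMatrix v z s).PosDef :=
  hP.add_posSemidef (posSemidef_sum _ fun i _ => posSemidef_smul_vecMulVec _ (hz i))

theorem norm_det_le_norm_det_add_frameMatrix {P : Matrix (Fin d) (Fin d) ℂ} (hP : P.PosDef)
    {z : ι → ℝ} (hz : ∀ i, 0 ≤ z i) (s : Finset ι) :
    ‖P.det‖ ≤ ‖(P + frameMatrix v z s).det‖ := by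
  induction s using Finset.induction_on with
  | empty => simp [frameMatrix]
  | insert i s hi ih =>
    have h : P + frameMatrix v z (insert i s) =
        P + frameMatrix v z s + (z i : ℂ) • vecMulVec (v i) (star (v i)) := by
      rw [frameMatrix, Finset.sum_insert hi, ← frameMatrix]; abel
    have hpd := posDef_add_frameMatrix (v := v) hP hz s
    rw [h, norm_det_add_smul_vecMulVec hpd _ (hz i)]
    refine ih.trans (le_mul_of_one_le_right (norm_nonneg _) ?_)
    have := (Complex.nonneg_iff.1 (hpd.inv.posSemidef.dotProduct_mulVec_nonneg (v i))).1
    nlinarith [mul_nonneg (hz i) this]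

theorem frameMatrix_basis {B : Finset ι} (hB : LinearIndepOn ℂ v (B : Set ι)) (hcard : B.card = d) :
    ∃ c : ℝ, 0 < c ∧ ∀ z : ι → ℝ, (∀ i, 0 < z i) →
      (frameMatrix v z B).PosDef ∧ ‖(frameMatrix v z B).det‖ = c * ∏ i ∈ B, z i := by
  let g : Fin d ≃ B := (B.equivFinOfCardEq hcard).symm
  let A : Matrix (Fin d) (Fin d) ℂ := Matrix.of fun l => star (v (g l))
  have hLI : LinearIndependent ℂ fun l => v (g l) :=
    LinearIndependent.comp hB (g : Fin d → B) g.injective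
  have hAu : IsUnit A := by
    have h1 : IsUnit (Matrix.of fun l => v (g l)) := linearIndependent_rows_iff_isUnit.1 hLI
    have h2 : A = (Matrix.of fun l => v (g l))ᴴᵀ := by ext; rfl
    rw [h2, isUnit_transpose, ← star_eq_conjTranspose]
    exact h1.star
  have hdet : A.det ≠ 0 := ((isUnit_iff_isUnit_det _).1 hAu).ne_zero
  refine ⟨‖A.det‖ ^ 2, by positivity, fun z hz => ?_⟩
  have hM : frameMatrix v z B = Aᴴ * diagonal (fun l => (z (g l) : ℂ)) * A := by
    ext a b
    rw [frameMatrix, ← Finset.sum_coe_sort, ← g.sum_comp, Matrix.mul_apply, Matrix.sum_apply]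
    refine Finset.sum_congr rfl fun l _ => ?_
    rw [mul_diagonal]
    simp [A, vecMulVec_apply]
    ring
  refine ⟨?_, ?_⟩
  · rw [hM]
    refine PosDef.conjTranspose_mul_mul_same (PosDef.diagonal fun l => by exact_mod_cast hz _) ?_
    exact mulVec_injective_of_isUnit hAu
  · rw [hM, det_mul, det_mul, det_conjTranspose, det_diagonal, norm_mul, norm_mul, norm_star,
      norm_prod]
    have : ∏ i ∈ B, z i = ∏ l, ‖(z (g l) : ℂ)‖ := by
      rw [← Finset.prod_coe_sort, ← g.prod_comp]
      exact Finset.prod_congr rfl fun l _ => by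
        rw [Complex.norm_real, Real.norm_of_nonneg (hz _).le]
    rw [this]; ring

theorem frameMatrix_univ_bound [Fintype ι] {B : Finset ι} (hB : LinearIndepOn ℂ v (B : Set ι))
    (hcard : B.card = d) :
    ∃ c : ℝ, ∀ t : ι → ℝ, (frameMatrix v (fun i => Real.exp (t i)) Finset.univ).PosDef ∧
      ∑ i ∈ B, t i - c ≤
        Real.log ‖(frameMatrix v (fun i => Real.exp (t i)) Finset.univ).det‖ := by
  obtain ⟨c, hc, h⟩ := frameMatrix_basis hB hcard
  refine ⟨- Real.log c, fun t => ?_⟩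
  obtain ⟨h1, h2⟩ := h (fun i => Real.exp (t i)) fun i => Real.exp_pos _
  have hsplit : frameMatrix v (fun i => Real.exp (t i)) Finset.univ =
      frameMatrix v (fun i => Real.exp (t i)) B + frameMatrix v (fun i => Real.exp (t i)) Bᶜ := by
    rw [frameMatrix, frameMatrix, frameMatrix, Finset.sum_add_sum_compl]
  rw [hsplit]
  refine ⟨posDef_add_frameMatrix h1 (fun i => (Real.exp_pos _).le) _, ?_⟩
  have h3 := norm_det_le_norm_det_add_frameMatrix (v := v) h1
    (fun i => (Real.exp_pos (t i)).le) Bᶜ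
  rw [h2, ← Real.exp_sum] at h3
  have h4 := Real.log_le_log (by positivity) h3
  rw [Real.log_mul hc.ne' (Real.exp_pos _).ne', Real.log_exp] at h4
  linarith

/-- A family of vectors without overcrowded subspaces can be weighted so that every weighted
vector has leverage at least half of the average leverage. -/
theorem exists_weights_leverage_ge [Fintype ι] [Nonempty ι] (hd : 0 < d)
    (hv : ∀ A : Finset ι, A.card * d ≤
      Fintype.card ι * Module.finrank ℂ (Submodule.span ℂ (v '' A))) :
    ∃ t : ι → ℝ, (frameMatrix v (fun i => Real.exp (t i)) Finset.univ).PosDef ∧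
      ∀ i, (d : ℝ) / 2 ≤ Fintype.card ι * (Real.exp (t i) *
        (star (v i) ⬝ᵥ (frameMatrix v (fun i => Real.exp (t i)) Finset.univ)⁻¹ *ᵥ v i).re) := by
  set n := Fintype.card ι with hn
  have hbasis := fun t : ι → ℝ => exists_basis_weight_ge v t d (by simp) hv
  have hbound : ∀ B : Finset ι, ∃ c : ℝ, LinearIndepOn ℂ v (B : Set ι) → B.card = d →
      ∀ t : ι → ℝ, (frameMatrix v (fun i => Real.exp (t i)) Finset.univ).PosDef ∧
      ∑ i ∈ B, t i - c ≤
        Real.log ‖(frameMatrix v (fun i => Real.exp (t i)) Finset.univ).det‖ := by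
    intro B
    by_cases h : LinearIndepOn ℂ v (B : Set ι) ∧ B.card = d
    · obtain ⟨c, hc⟩ := frameMatrix_univ_bound h.1 h.2
      exact ⟨c, fun _ _ => hc⟩
    · exact ⟨0, fun h1 h2 => absurd ⟨h1, h2⟩ h⟩
  choose c hc using hbound
  obtain ⟨c₀, hc₀⟩ := (Set.finite_range c).bddAbove
  let pot : (ι → ℝ) → ℝ := fun t =>
    n * Real.log ‖(frameMatrix v (fun i => Real.exp (t i)) Finset.univ).det‖ - d * ∑ i, t i
  have hpd : ∀ t : ι → ℝ, (frameMatrix v (fun i => Real.exp (t i)) Finset.univ).PosDef := by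
    intro t
    obtain ⟨B, hB, hcard, -⟩ := hbasis t
    exact (hc B hB hcard t).1
  have hpot : ∀ t, -(n * c₀) ≤ pot t := by
    intro t
    obtain ⟨B, hB, hcard, h⟩ := hbasis t
    have h1 := (hc B hB hcard t).2
    have h2 : c B ≤ c₀ := hc₀ ⟨B, rfl⟩
    have h3 : (n : ℝ) * (∑ i ∈ B, t i - c₀) ≤
        n * Real.log ‖(frameMatrix v (fun i => Real.exp (t i)) Finset.univ).det‖ :=
      mul_le_mul_of_nonneg_left (by linarith) (Nat.cast_nonneg _)
    simp only [pot]
    linarith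
  have hbdd : BddBelow (Set.range pot) := ⟨_, by rintro _ ⟨t, rfl⟩; exact hpot t⟩
  obtain ⟨t, ht⟩ := exists_lt_of_ciInf_lt (show (⨅ t, pot t) < (⨅ t, pot t) + 1 / 10 by linarith)
  refine ⟨t, hpd t, fun i => ?_⟩
  let t' : ι → ℝ := Function.update t i (t i + Real.log 2)
  have ht' : pot t < pot t' + 1 / 10 := ht.trans_le (by linarith [ciInf_le hbdd t'])
  have hsum : ∑ j, t' j = ∑ j, t j + Real.log 2 := by
    have : ∀ j, t' j = t j + if j = i then Real.log 2 else 0 := by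
      intro j
      by_cases h : j = i
      · subst h; simp [t']
      · simp [t', h]
    simp [this, Finset.sum_add_distrib]
  have hframe : frameMatrix v (fun j => Real.exp (t' j)) Finset.univ =
      frameMatrix v (fun j => Real.exp (t j)) Finset.univ +
        ((Real.exp (t i) : ℝ) : ℂ) • vecMulVec (v i) (star (v i)) := by
    have : ∀ j, ((Real.exp (t' j) : ℝ) : ℂ) • vecMulVec (v j) (star (v j)) =
        ((Real.exp (t j) : ℝ) : ℂ) • vecMulVec (v j) (star (v j)) +
        if j = i then ((Real.exp (t i) : ℝ) : ℂ) • vecMulVec (v i) (star (v i)) else 0 := by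
      intro j
      by_cases h : j = i
      · subst h
        simp only [t', Function.update_self, if_true]
        rw [← add_smul, Real.exp_add, Real.exp_log (by norm_num)]
        push_cast
        ring_nf
      · simp [t', h]
    simp only [frameMatrix, this, Finset.sum_add_distrib]
    simp
  set M := frameMatrix v (fun j => Real.exp (t j)) Finset.univ with hM
  have hx : 0 ≤ Real.exp (t i) * (star (v i) ⬝ᵥ M⁻¹ *ᵥ v i).re :=
    mul_nonneg (Real.exp_pos _).le
      (Complex.nonneg_iff.1 ((hpd t).inv.posSemidef.dotProduct_mulVec_nonneg (v i))).1
  set x := Real.exp (t i) * (star (v i) ⬝ᵥ M⁻¹ *ᵥ v i).re with hxdef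
  have hdet : 0 < ‖M.det‖ := norm_pos_iff.2 (hpd t).det_pos.ne'
  have hlog : Real.log ‖(frameMatrix v (fun j => Real.exp (t' j)) Finset.univ).det‖ =
      Real.log ‖M.det‖ + Real.log (1 + x) := by
    rw [hframe, norm_det_add_smul_vecMulVec (hpd t) _ (Real.exp_pos _).le, ← hM, ← hxdef,
      Real.log_mul hdet.ne' (by positivity)]
  simp only [pot] at ht'
  rw [hlog, hsum, ← hM] at ht'
  have h1 : Real.log (1 + x) ≤ x := by
    have := Real.log_le_sub_one_of_pos (show 0 < 1 + x by positivity)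
    linarith
  have h2 : (n : ℝ) * Real.log (1 + x) ≤ n * x := mul_le_mul_of_nonneg_left h1 (Nat.cast_nonneg _)
  have h3 : (1 : ℝ) ≤ d := by exact_mod_cast hd
  nlinarith [Real.log_two_gt_d9]

end Frame

section Radial

open Matrix

open scoped ComplexOrder MatrixOrder Matrix.Norms.L2Operator

variable {d : ℕ} {ι : Type*} [Fintype ι] [Nonempty ι] {v : ι → Fin d → ℂ}

theorem Matrix.PosDef.exists_conjTranspose_mul_self {P : Matrix (Fin d) (Fin d) ℂ}
    (hP : P.PosDef) : ∃ R : Matrix (Fin d) (Fin d) ℂ, P = Rᴴ * R ∧ IsUnit R := by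
  obtain ⟨R, hR⟩ := CStarAlgebra.nonneg_iff_eq_star_mul_self.1
    (nonneg_iff_posSemidef.2 hP.posSemidef)
  refine ⟨R, hR, ?_⟩
  have := hP.isUnit
  rw [hR, isUnit_iff_isUnit_det, det_mul] at this
  exact (isUnit_iff_isUnit_det _).2 (isUnit_of_mul_isUnit_right this)

/-- A linear change of variables brings a family of vectors without overcrowded subspaces into
an approximately isotropic position. -/
theorem exists_linearMap_sum_sqCos_le (hd : 0 < d)
    (hv : ∀ A : Finset ι, A.card * d ≤
      Fintype.card ι * Module.finrank ℂ (Submodule.span ℂ (v '' A))) :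
    ∃ φ : (Fin d → ℂ) →ₗ[ℂ] EuclideanSpace ℂ (Fin d), Function.Injective φ ∧
      ∀ i, ∑ j, sqCos (φ (v i)) (φ (v j)) ≤ 2 * Fintype.card ι / d := by
  obtain ⟨t, hM, ht⟩ := exists_weights_leverage_ge hd hv
  set M := frameMatrix v (fun i => Real.exp (t i)) Finset.univ with hMdef
  obtain ⟨R, hR, hRu⟩ := hM.inv.exists_conjTranspose_mul_self
  let φ : (Fin d → ℂ) →ₗ[ℂ] EuclideanSpace ℂ (Fin d) :=
    (WithLp.linearEquiv 2 ℂ (Fin d → ℂ)).symm.toLinearMap ∘ₗ R.mulVecLin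
  have hinner : ∀ x y, inner ℂ (φ x) (φ y) = star x ⬝ᵥ M⁻¹ *ᵥ y := by
    intro x y
    rw [EuclideanSpace.inner_eq_star_dotProduct, hR, ← mulVec_mulVec, dotProduct_mulVec,
      ← star_mulVec, dotProduct_comm]
    rfl
  have hnorm : ∀ x, ‖φ x‖ ^ 2 = (star x ⬝ᵥ M⁻¹ *ᵥ x).re := by
    intro x
    rw [← hinner, ← inner_self_eq_norm_sq (𝕜 := ℂ)]
    rfl
  have hdet : IsUnit M.det := (isUnit_iff_isUnit_det _).1 hM.isUnit
  have hsum : ∀ x, ∑ j, Real.exp (t j) * ‖inner ℂ (φ x) (φ (v j))‖ ^ 2 = ‖φ x‖ ^ 2 := by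
    intro x
    have h1 : star x ⬝ᵥ M⁻¹ *ᵥ x = (star x ᵥ* M⁻¹) ⬝ᵥ M *ᵥ (M⁻¹ *ᵥ x) := by
      rw [mulVec_mulVec, mul_nonsing_inv _ hdet, one_mulVec, dotProduct_mulVec]
    have h2 : (star x ᵥ* M⁻¹) ⬝ᵥ M *ᵥ (M⁻¹ *ᵥ x) =
        ∑ j, ((Real.exp (t j) * ‖inner ℂ (φ x) (φ (v j))‖ ^ 2 : ℝ) : ℂ) := by
      generalize M⁻¹ = N at hinner ⊢
      rw [hMdef, frameMatrix, sum_mulVec, dotProduct_sum]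
      refine Finset.sum_congr rfl fun j _ => ?_
      rw [smul_mulVec, dotProduct_smul, vecMulVec_mulVec, ← hinner (v j) x,
        ← inner_conj_symm (φ (v j)) (φ x)]
      have h3 : inner ℂ (φ x) (φ (v j)) = (star x ᵥ* N) ⬝ᵥ v j := by
        rw [hinner, dotProduct_mulVec]
      rw [op_smul_eq_smul, dotProduct_smul, ← h3, smul_eq_mul, smul_eq_mul,
        ← Complex.normSq_eq_conj_mul_self,
        Complex.normSq_eq_norm_sq]
      push_cast
      rfl
    rw [hnorm, h1, h2, ← Complex.ofReal_sum, Complex.ofReal_re]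
  refine ⟨φ, ?_, fun i => ?_⟩
  · exact (WithLp.linearEquiv 2 ℂ (Fin d → ℂ)).symm.injective.comp (mulVec_injective_of_isUnit hRu)
  · have hpos : ∀ j, 0 < ‖φ (v j)‖ := by
      intro j
      refine lt_of_le_of_ne (norm_nonneg _) fun h => ?_
      have h1 := ht j
      rw [← hnorm, ← h] at h1
      have : (0 : ℝ) < d := by exact_mod_cast hd
      norm_num at h1
      linarith
    have hd' : (0 : ℝ) < d := by exact_mod_cast hd
    have hn' : (0 : ℝ) < Fintype.card ι := by exact_mod_cast Fintype.card_pos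
    have hle : ∀ j, sqCos (φ (v i)) (φ (v j)) ≤ 2 * Fintype.card ι / d *
        (Real.exp (t j) * ‖inner ℂ (φ (v i)) (φ (v j))‖ ^ 2 / ‖φ (v i)‖ ^ 2) := by
      intro j
      have h1 := ht j
      rw [← hnorm] at h1
      have hi := hpos i
      have hj := hpos j
      rw [sqCos, div_pow, mul_pow, mul_div_assoc', div_mul_eq_mul_div, div_div, div_le_div_iff₀
        (by positivity) (by positivity)]
      have h2 : (0:ℝ) ≤ ‖inner ℂ (φ (v i)) (φ (v j))‖ ^ 2 * ‖φ (v i)‖ ^ 2 := by positivity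
      nlinarith [mul_le_mul_of_nonneg_left h1 h2]
    refine (Finset.sum_le_sum fun j _ => hle j).trans ?_
    rw [← Finset.mul_sum, ← Finset.sum_div, hsum, div_self (pow_ne_zero 2 (hpos i).ne'), mul_one]

end Radial

section Code

variable {m : ℕ}

/-- The coordinates on which some element of `C` does not vanish. -/
noncomputable def codeSupport (C : Submodule ℂ (Fin m → ℂ)) : Finset (Fin m) :=
  Finset.univ.filter fun i => ∃ x ∈ C, x i ≠ 0

theorem mem_codeSupport {C : Submodule ℂ (Fin m → ℂ)} {i : Fin m} :
    i ∈ codeSupport C ↔ ∃ x ∈ C, x i ≠ 0 := by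
  simp [codeSupport]

theorem card_codeSupport_le (C : Submodule ℂ (Fin m → ℂ)) : (codeSupport C).card ≤ m := by
  simpa using Finset.card_le_univ (codeSupport C)

theorem codeSupport_mono {C D : Submodule ℂ (Fin m → ℂ)} (h : C ≤ D) :
    codeSupport C ⊆ codeSupport D := by
  intro i hi
  obtain ⟨x, hx, hxi⟩ := mem_codeSupport.1 hi
  exact mem_codeSupport.2 ⟨x, h hx, hxi⟩

/-- Every nonzero code has a nonzero subcode minimizing the ratio of support size and dimension. -/
theorem exists_subcode_minimal_slope {C : Submodule ℂ (Fin m → ℂ)} (hC : C ≠ ⊥) :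
    ∃ C' ≤ C, C' ≠ ⊥ ∧ ∀ D ≤ C, (codeSupport C').card * Module.finrank ℂ D ≤
      (codeSupport D).card * Module.finrank ℂ C' := by
  let slope : Submodule ℂ (Fin m → ℂ) → ℚ := fun D =>
    ((codeSupport D).card : ℚ) / Module.finrank ℂ D
  have hfin : (slope '' {D | D ≤ C ∧ D ≠ ⊥}).Finite := by
    refine ((Finset.range (m + 1) ×ˢ Finset.range (m + 1)).image
      fun p : ℕ × ℕ => (p.1 : ℚ) / p.2).finite_toSet.subset ?_
    rintro _ ⟨D, -, rfl⟩
    have h1 := card_codeSupport_le D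
    have h2 : Module.finrank ℂ D ≤ m := by simpa using D.finrank_le
    exact Finset.mem_coe.2 (Finset.mem_image.2 ⟨((codeSupport D).card, Module.finrank ℂ D),
      by simp; omega, rfl⟩)
  obtain ⟨_, ⟨C', ⟨hle, hne⟩, rfl⟩, hmin⟩ :=
    Set.exists_min_image _ id hfin ⟨_, ⟨C, ⟨le_rfl, hC⟩, rfl⟩⟩
  refine ⟨C', hle, hne, fun D hD => ?_⟩
  by_cases hD0 : D = ⊥
  · rw [hD0, finrank_bot, mul_zero]
    exact Nat.zero_le _
  have h := hmin _ ⟨D, ⟨hD, hD0⟩, rfl⟩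
  have hpos : ∀ D : Submodule ℂ (Fin m → ℂ), D ≠ ⊥ → (0 : ℚ) < Module.finrank ℂ D := by
    intro D hD
    exact_mod_cast Nat.pos_of_ne_zero fun h0 => hD (Submodule.finrank_eq_zero.1 h0)
  simp only [id, slope] at h
  rw [div_le_div_iff₀ (hpos _ hne) (hpos _ hD0)] at h
  exact_mod_cast h

/-- The coordinate functionals of a code. -/
noncomputable def coordFunctional (C : Submodule ℂ (Fin m → ℂ)) (i : Fin m) : Module.Dual ℂ C :=
  LinearMap.proj i ∘ₗ C.subtype

theorem coordFunctional_mem_span_pair {C : Submodule ℂ (Fin m → ℂ)} {i j k : Fin m}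
    (h : ∀ x ∈ C, x j = 0 → x k = 0 → x i = 0) :
    coordFunctional C i ∈ Submodule.span ℂ {coordFunctional C j, coordFunctional C k} := by
  have := mem_span_of_iInf_ker_le_ker (L := ![coordFunctional C j, coordFunctional C k])
    (K := coordFunctional C i) (by
      intro x hx
      simp only [Submodule.mem_iInf, LinearMap.mem_ker] at hx ⊢
      exact h x x.2 (hx 0) (hx 1))
  simpa [Set.pair_comm] using this

theorem coordFunctional_eq_zero_iff {C : Submodule ℂ (Fin m → ℂ)} {i : Fin m} :
    coordFunctional C i = 0 ↔ i ∉ codeSupport C := by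
  rw [mem_codeSupport, LinearMap.ext_iff]
  simp [coordFunctional]

/-- In a code of minimal slope, no subspace contains too many coordinate functionals. -/
theorem card_mul_finrank_le {C : Submodule ℂ (Fin m → ℂ)}
    (hmin : ∀ D ≤ C, (codeSupport C).card * Module.finrank ℂ D ≤
      (codeSupport D).card * Module.finrank ℂ C) {A : Finset (Fin m)} (hA : A ⊆ codeSupport C) :
    A.card * Module.finrank ℂ C ≤ (codeSupport C).card *
      Module.finrank ℂ (Submodule.span ℂ (coordFunctional C '' A)) := by
  set W := Submodule.span ℂ (coordFunctional C '' A) with hW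
  have h1 := Subspace.finrank_add_finrank_dualCoannihilator_eq W
  have h2 := hmin (W.dualCoannihilator.map C.subtype) (Submodule.map_subtype_le _ _)
  rw [Submodule.finrank_map_subtype_eq] at h2
  have h3 : (codeSupport (W.dualCoannihilator.map C.subtype)).card + A.card ≤
      (codeSupport C).card := by
    rw [← Finset.card_union_of_disjoint]
    · exact Finset.card_le_card (Finset.union_subset
        (codeSupport_mono (Submodule.map_subtype_le _ _)) hA)
    · refine Finset.disjoint_left.2 fun i hi hiA => ?_
      obtain ⟨_, ⟨x, hx, rfl⟩, hxi⟩ := mem_codeSupport.1 hi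
      exact hxi ((Submodule.mem_dualCoannihilator _).1 hx (coordFunctional C i)
        (Submodule.subset_span ⟨i, hiA, rfl⟩))
  nlinarith

/-- A code in which every symbol can be recovered linearly from two symbols outside any given small
set of positions has bounded dimension. -/
theorem finrank_le_of_recovery {C : Submodule ℂ (Fin m → ℂ)} {δ : ℝ} (hδ : 0 < δ) (hC : C ≠ ⊥)
    (hrec : ∀ i, (∃ x ∈ C, x i ≠ 0) → ∀ T : Finset (Fin m), (T.card : ℝ) ≤ δ * m →
      ∃ j ∉ T, ∃ k ∉ T, ∀ x ∈ C, x j = 0 → x k = 0 → x i = 0) :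
    (Module.finrank ℂ C : ℝ) ≤ 384 / δ ^ 2 := by
  obtain ⟨C', hle, hne, hmin⟩ := exists_subcode_minimal_slope hC
  set d := Module.finrank ℂ C' with hd
  have hd0 : 0 < d := Nat.pos_of_ne_zero fun h => hne (Submodule.finrank_eq_zero.1 h)
  let ι := codeSupport C'
  have hι : Fintype.card ι = (codeSupport C').card := Fintype.card_coe _
  obtain ⟨x, hx, hx0⟩ := C'.ne_bot_iff.1 hne
  obtain ⟨i₀, hi₀⟩ := Function.ne_iff.1 hx0
  have : Nonempty ι := ⟨⟨i₀, mem_codeSupport.2 ⟨x, hx, hi₀⟩⟩⟩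
  let eqv : Module.Dual ℂ C' ≃ₗ[ℂ] (Fin d → ℂ) :=
    LinearEquiv.ofFinrankEq _ _ (by rw [Subspace.dual_finrank_eq]; simp [hd])
  obtain ⟨φ, hφ, hL⟩ := exists_linearMap_sum_sqCos_le (v := fun i : ι => eqv (coordFunctional C' i))
    hd0 (by
      intro A
      have h := card_mul_finrank_le (fun D hD => hmin D (hD.trans hle))
        (A := A.map (Function.Embedding.subtype _)) (by
          intro i hi
          obtain ⟨j, -, rfl⟩ := Finset.mem_map.1 hi
          exact j.2)
      rw [Finset.card_map] at h
      rw [hι]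
      refine h.trans (Nat.mul_le_mul_left _ (le_of_eq ?_))
      have himage : (fun i : ι => eqv (coordFunctional C' i)) '' A =
          eqv.toLinearMap '' (coordFunctional C' '' A.map (Function.Embedding.subtype _)) := by
        ext y
        simp
      rw [himage, ← Submodule.map_span, LinearEquiv.finrank_map_eq])
  set L : ℝ := 2 * Fintype.card ι / d with hLdef
  let e : ι → EuclideanSpace ℂ (Fin d) := fun i => φ (eqv (coordFunctional C' i))
  have hmn : (Fintype.card ι : ℝ) ≤ m := by
    rw [hι]; exact_mod_cast card_codeSupport_le C'
  have hn : (0 : ℝ) < Fintype.card ι := by exact_mod_cast Fintype.card_pos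
  have hm : (0 : ℝ) < m := hn.trans_le hmn
  have hδ1 : δ < 1 := by
    by_contra! h
    obtain ⟨j, hj, -⟩ := hrec i₀ ⟨x, hle hx, hi₀⟩ Finset.univ (by
      simpa using le_mul_of_one_le_left hm.le h)
    simp at hj
  have he : ∀ i, e i ≠ 0 := by
    intro i
    have h1 : coordFunctional C' i ≠ 0 := fun h => coordFunctional_eq_zero_iff.1 h i.2
    simpa [e, map_eq_zero_iff φ hφ] using h1
  have hspan : ∀ i : ι, ∀ T : Finset ι, (T.card : ℝ) ≤ δ * m →
      ∃ j ∉ T, ∃ k ∉ T, e i ∈ Submodule.span ℂ {e j, e k} := by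
    intro i T hT
    obtain ⟨y, hy, hyi⟩ := mem_codeSupport.1 i.2
    obtain ⟨j, hj, k, hk, hjk⟩ := hrec i ⟨y, hle hy, hyi⟩ (T.map (Function.Embedding.subtype _))
      (by simpa using hT)
    have h := Submodule.mem_map_of_mem (f := φ ∘ₗ eqv.toLinearMap)
      (coordFunctional_mem_span_pair fun x hx => hjk x (hle hx))
    rw [Submodule.map_span, Set.image_pair] at h
    have hmem : ∀ l, (hl : l ∈ codeSupport C') →
        l ∉ T.map (Function.Embedding.subtype _) → (⟨l, hl⟩ : ι) ∉ T :=
      fun l hl h1 h2 => h1 (Finset.mem_map.2 ⟨_, h2, rfl⟩)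
    have hzero : ∀ l, l ∉ codeSupport C' →
        (φ ∘ₗ eqv.toLinearMap) (coordFunctional C' l) = 0 := by
      intro l hl
      rw [coordFunctional_eq_zero_iff.2 hl, map_zero]
    by_cases hjs : j ∈ codeSupport C' <;> by_cases hks : k ∈ codeSupport C'
    · exact ⟨⟨j, hjs⟩, hmem j hjs hj, ⟨k, hks⟩, hmem k hks hk, h⟩
    · rw [hzero k hks, Set.pair_comm, Submodule.span_insert_zero] at h
      exact ⟨⟨j, hjs⟩, hmem j hjs hj, ⟨j, hjs⟩, hmem j hjs hj,
        by rw [Set.pair_eq_singleton]; exact h⟩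
    · rw [hzero j hjs, Submodule.span_insert_zero] at h
      exact ⟨⟨k, hks⟩, hmem k hks hk, ⟨k, hks⟩, hmem k hks hk,
        by rw [Set.pair_eq_singleton]; exact h⟩
    · rw [hzero j hjs, hzero k hks, Set.pair_eq_singleton, Submodule.span_zero_singleton] at h
      exact absurd ((Submodule.mem_bot ℂ).1 h) (he i)
  have hL192 : δ ^ 2 * m / 192 ≤ L := by
    by_cases hbig : L ≤ δ * m / 4
    · have h1 : δ * Fintype.card ι ≤ δ * m := mul_le_mul_of_nonneg_left hmn hδ.le
      have h2 := mul_le_of_recovery he hL hspan (r := δ * Fintype.card ι / 4)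
        (by nlinarith) (by nlinarith)
      have h3 : (Fintype.card ι : ℝ) * (δ ^ 2 * m / 192) ≤ Fintype.card ι * L := by
        have h4 : δ * m / 2 ≤ δ * m - L - δ * Fintype.card ι / 4 := by linarith
        have h5 := mul_le_mul_of_nonneg_left h4 (mul_nonneg hδ.le hn.le)
        nlinarith
      exact le_of_mul_le_mul_left h3 hn
    · nlinarith [mul_pos hδ hm]
  have hd' : (0 : ℝ) < d := by exact_mod_cast hd0
  have h1 : (Fintype.card ι : ℝ) * Module.finrank ℂ C ≤ m * d := by
    rw [hι]
    exact_mod_cast (hmin C le_rfl).trans (Nat.mul_le_mul_right _ (card_codeSupport_le C))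
  rw [hLdef, le_div_iff₀ hd'] at hL192
  rw [le_div_iff₀ (by positivity)]
  have h2 : (Fintype.card ι : ℝ) * (Module.finrank ℂ C * δ ^ 2) ≤ Fintype.card ι * 384 := by
    nlinarith [mul_le_mul_of_nonneg_right h1 (sq_nonneg δ)]
  exact le_of_mul_le_mul_left h2 hn

end Code

/-- Impossibility of 2-query LCCs over `ℂ`: there is a universal constant `K` such
that every linear subspace `C ⊆ ℂ^m` admitting a randomized 2-query local corrector
(modeled by a finite nonempty seed set `S`, query positions `pos` and decoding
functions `f`) that for every codeword `x`, index `i`, and error vector `v` of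
Hamming weight at most `δ m` outputs `x i` on at least a `3/4` fraction of the
seeds, has dimension at most `K / δ⁹`. -/
theorem no_two_query_lcc_over_C :
    ∃ K : ℝ, 0 < K ∧ ∀ (m : ℕ) (δ : ℝ), 0 < δ →
      ∀ (C : Submodule ℂ (Fin m → ℂ)) (S : Type) (_ : Fintype S) (_ : Nonempty S)
        (pos : S → Fin m → Fin m × Fin m) (f : S → Fin m → ℂ → ℂ → ℂ),
      (∀ x ∈ C, ∀ i : Fin m, ∀ v : Fin m → ℂ,
        ((Finset.univ.filter fun j : Fin m => v j ≠ 0).card : ℝ) ≤ δ * m →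
        (3 / 4 : ℝ) * (Fintype.card S : ℝ) ≤
          ((Finset.univ.filter fun s : S =>
            f s i ((x + v) (pos s i).1) ((x + v) (pos s i).2) = x i).card : ℝ)) →
      (Module.finrank ℂ C : ℝ) ≤ K / δ ^ 9 := by
  refine ⟨384, by norm_num, fun m δ hδ C S _ _ pos f hdec => ?_⟩
  by_cases hC : C = ⊥
  · rw [hC, finrank_bot, Nat.cast_zero]
    positivity
  have hrec : ∀ i, (∃ x ∈ C, x i ≠ 0) → ∀ T : Finset (Fin m), (T.card : ℝ) ≤ δ * m →
      ∃ j ∉ T, ∃ k ∉ T, ∀ x ∈ C, x j = 0 → x k = 0 → x i = 0 := by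
    intro i hi T hT
    refine exists_recovery_pair C (fun s => (pos s i).1) (fun s => (pos s i).2) (fun s => f s i) i T
      (fun x hx v hv => hdec x hx i v (le_trans ?_ hT)) hi
    refine Nat.cast_le.2 (Finset.card_le_card fun j hj => ?_)
    by_contra hjT
    exact (Finset.mem_filter.1 hj).2 (hv j hjT)
  have hδ1 : δ ≤ 1 := by
    by_contra! h
    obtain ⟨x, hx, hx0⟩ := C.ne_bot_iff.1 hC
    obtain ⟨i, hi⟩ := Function.ne_iff.1 hx0
    obtain ⟨j, hj, -⟩ := hrec i ⟨x, hx, hi⟩ Finset.univ (by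
      simpa using le_mul_of_one_le_left (Nat.cast_nonneg m) h.le)
    simp at hj
  refine (finrank_le_of_recovery hδ hC hrec).trans ?_
  exact div_le_div_of_nonneg_left (by norm_num) (by positivity)
    (pow_le_pow_of_le_one hδ.le hδ1 (by norm_num))
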